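/- For all 0 < κ_D < κ_O and all p ∈ [0,1], the thermodynamic limits lim_{L→∞, L even} L^{−2} log Z_{L,V} and lim_{L→∞, L even} L^{−2} log Z*_{L,V} both exist and are equal. -/

import Mathlib

open MeasureTheory Real Filter
open scoped ENNReal

noncomputable section

abbrev Torus (L : ℕ) := ZMod L × ZMod L
abbrev Edge (L : ℕ) := Torus L × Bool
def estep (L : ℕ) (d : Bool) : Torus L := if d then (1, 0) else (0, 1)
def etarget {L : ℕ} (e : Edge L) : Torus L := e.1 + estep L e.2
def grad {L : ℕ} (φ : Torus L → ℝ) : Edge L → ℝ := fun e => φ (etarget e) - φ e.1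

def nuL (L : ℕ) [NeZero L] : Measure (Edge L → ℝ) :=
  Measure.map (fun φ : Torus L → ℝ => grad φ)
    (Measure.map
      (fun ψ : {x : Torus L // x ≠ 0} → ℝ => fun x : Torus L =>
        if h : x = 0 then (0 : ℝ) else ψ ⟨x, h⟩)
      volume)

def energy (L : ℕ) [NeZero L] (κ η : Edge L → ℝ) : ℝ :=
  (1 / 2) * ∑ b : Edge L, κ b * η b ^ 2

def ZL (L : ℕ) [NeZero L] (κ : Edge L → ℝ) : ℝ≥0∞ :=
  ∫⁻ η, ENNReal.ofReal (Real.exp (-(energy L κ η))) ∂(nuL L)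

/-- Product a priori measure on the `κ`'s. -/
def rhoL (L : ℕ) [NeZero L] (ρ : Measure ℝ) : Measure (Edge L → ℝ) :=
  Measure.pi fun _ : Edge L => ρ

/-- Partition function of the extended model. -/
def ZLV (L : ℕ) [NeZero L] (ρ : Measure ℝ) : ℝ≥0∞ :=
  ∫⁻ x : (Edge L → ℝ) × (Edge L → ℝ),
    ENNReal.ofReal (Real.exp (-(energy L x.2 x.1))) ∂((nuL L).prod (rhoL L ρ))

/-- The extended gradient Gibbs measure `Q_L` on pairs `(η, κ)`. -/
def QL (L : ℕ) [NeZero L] (ρ : Measure ℝ) : Measure ((Edge L → ℝ) × (Edge L → ℝ)) :=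
  (ZLV L ρ)⁻¹ •
    (((nuL L).prod (rhoL L ρ)).withDensity fun x =>
      ENNReal.ofReal (Real.exp (-(energy L x.2 x.1))))

/-- The `η`-marginal `P_L` of `Q_L`. -/
def PL (L : ℕ) [NeZero L] (ρ : Measure ℝ) : Measure (Edge L → ℝ) :=
  (QL L ρ).map Prod.fst

/-- Topological support of a measure on `ℝ`. -/
def measSupport (ρ : Measure ℝ) : Set ℝ := {x | ∀ U ∈ nhds x, 0 < ρ U}

/-- The a priori measure `ν*_L`: pushforward of `ν_L ⊗ Leb(ℝ²)` under
`(ζ,(s,t)) ↦ η` with `η_b = ζ_b + s/L²` (horizontal `b`) or `ζ_b + t/L²`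
(vertical `b`). -/
def nuStar (L : ℕ) [NeZero L] : Measure (Edge L → ℝ) :=
  Measure.map
    (fun q : (Edge L → ℝ) × (ℝ × ℝ) => fun b : Edge L =>
      q.1 b + (if b.2 then q.2.1 else q.2.2) / (L : ℝ) ^ 2)
    ((nuL L).prod volume)

instance two_mul_succ_neZero (n : ℕ) : NeZero (2 * (n + 1)) := ⟨by omega⟩

/-- The two-point a priori bond-weight measure `ρ = p δ_{κO} + (1-p) δ_{κD}`. -/
def rhoTwo (κO κD p : ℝ) : Measure ℝ :=
  ENNReal.ofReal p • Measure.dirac κO + ENNReal.ofReal (1 - p) • Measure.dirac κD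

/-- Partition function of the extended model with a priori measure `ν*_L`. -/
def ZLVstar (L : ℕ) [NeZero L] (ρ : Measure ℝ) : ℝ≥0∞ :=
  ∫⁻ x : (Edge L → ℝ) × (Edge L → ℝ),
    ENNReal.ofReal (Real.exp (-(energy L x.2 x.1))) ∂((nuStar L).prod (rhoL L ρ))

/-- The a priori measure on fields on the torus that vanish on `A`. -/
def pinnedMeasure (L : ℕ) [NeZero L] (A : Finset (Torus L)) : Measure (Torus L → ℝ) :=
  Measure.pi fun x => if x ∈ A then Measure.dirac 0 else volume

instance sigmaFinite_pin {α : Type*} (x : α) (A : Finset α) [DecidableEq α] :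
    SigmaFinite (if x ∈ A then Measure.dirac (0 : ℝ) else volume) := by
  split_ifs <;> infer_instance

instance (L : ℕ) [NeZero L] (A : Finset (Torus L)) : SigmaFinite (pinnedMeasure L A) := by
  unfold pinnedMeasure; infer_instance

/-- The unnormalized Boltzmann weight of a gradient field. -/
def boltzmann (L : ℕ) [NeZero L] (κ η : Edge L → ℝ) : ℝ≥0∞ :=
  ENNReal.ofReal (Real.exp (-(energy L κ η)))

/-- The partition function of fields pinned to zero on `A`, for fixed bond weights. -/
def pinnedZ (L : ℕ) [NeZero L] (A : Finset (Torus L)) (κ : Edge L → ℝ) : ℝ≥0∞ :=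
  ∫⁻ φ, boltzmann L κ (grad φ) ∂(pinnedMeasure L A)

/-- The partition function of fields pinned to zero on `A`, averaged over bond weights. -/
def avgPinnedZ (L : ℕ) [NeZero L] (A : Finset (Torus L)) (ρ : Measure ℝ) : ℝ≥0∞ :=
  ∫⁻ κ, pinnedZ L A κ ∂(rhoL L ρ)

lemma grad_add {L : ℕ} (φ ψ : Torus L → ℝ) : grad (φ + ψ) = grad φ + grad ψ := by
  ext e; simp only [grad, Pi.add_apply]; ring

lemma grad_smul {L : ℕ} (c : ℝ) (φ : Torus L → ℝ) : grad (c • φ) = c • grad φ := by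
  ext e; simp only [grad, Pi.smul_apply, smul_eq_mul]; ring

lemma measurable_grad {L : ℕ} : Measurable (grad : (Torus L → ℝ) → Edge L → ℝ) := by
  unfold grad; fun_prop

section Basic

variable {L : ℕ} [NeZero L]

lemma measurable_boltzmann_comp {α : Type*} [MeasurableSpace α] {f g : α → Edge L → ℝ}
    (hf : Measurable f) (hg : Measurable g) : Measurable fun a => boltzmann L (f a) (g a) := by
  have hf' := measurable_pi_iff.1 hf
  have hg' := measurable_pi_iff.1 hg
  unfold boltzmann energy
  fun_prop

lemma measurable_boltzmann (κ : Edge L → ℝ) : Measurable (boltzmann L κ) :=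
  measurable_boltzmann_comp measurable_const measurable_id

lemma pinnedMeasure_ae_eq_zero (A : Finset (Torus L)) :
    ∀ᵐ φ ∂(pinnedMeasure L A), ∀ x ∈ A, φ x = 0 := by
  refine ae_all_iff.2 fun x => ?_
  by_cases hx : x ∈ A
  · have h : ∀ᵐ t ∂(if x ∈ A then Measure.dirac (0 : ℝ) else volume), t = 0 := by
      rw [if_pos hx, ae_dirac_eq]; rfl
    exact ((Measure.tendsto_eval_ae_ae (i := x)).eventually h).mono fun φ hφ _ => hφ
  · simp [hx]

lemma pinnedMeasure_map_add (A : Finset (Torus L)) (m : Torus L → ℝ) (hm : ∀ x ∈ A, m x = 0) :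
    MeasurePreserving (fun φ => φ + m) (pinnedMeasure L A) (pinnedMeasure L A) := by
  refine measurePreserving_pi _ _ (f := fun x t => t + m x) fun x => ?_
  split_ifs with hx
  · simp only [hm x hx, add_zero]; exact MeasurePreserving.id _
  · exact measurePreserving_add_right _ _

lemma measurable_update_pair {α : Type*} [DecidableEq α] (x : α) :
    Measurable (fun q : ℝ × (α → ℝ) => Function.update q.2 x q.1) := by
  refine measurable_pi_iff.2 fun y => ?_
  by_cases h : y = x
  · subst h; simpa using measurable_fst
  · simpa [h, Function.comp_def] using (measurable_pi_apply y).comp measurable_snd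

/-- The field at one free site decouples as an independent Lebesgue variable. -/
lemma pinnedMeasure_eq_map_update (A : Finset (Torus L)) (x : Torus L) (hx : x ∉ A) :
    pinnedMeasure L A = Measure.map (fun q : ℝ × (Torus L → ℝ) => Function.update q.2 x q.1)
      (volume.prod (pinnedMeasure L (insert x A))) := by
  have hmeas := measurable_update_pair x
  refine Measure.pi_eq fun s hs => ?_
  rw [Measure.map_apply hmeas (MeasurableSet.univ_pi hs)]
  have : (fun q : ℝ × (Torus L → ℝ) => Function.update q.2 x q.1) ⁻¹' (Set.univ.pi s)
      = s x ×ˢ (Set.univ.pi (Function.update s x Set.univ)) := by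
    ext q
    simp only [Set.mem_preimage, Set.mem_pi, Set.mem_univ, true_imp_iff, Set.mem_prod]
    constructor
    · intro h
      refine ⟨by simpa using h x, fun y => ?_⟩
      by_cases hy : y = x
      · subst hy; simp
      · simpa [hy] using h y
    · rintro ⟨h1, h2⟩ y
      by_cases hy : y = x
      · subst hy; simpa using h1
      · simpa [hy] using h2 y
  rw [this, Measure.prod_prod, pinnedMeasure, Measure.pi_pi,
    ← Finset.mul_prod_erase _ _ (Finset.mem_univ x), ← Finset.mul_prod_erase Finset.univ
      (fun i => (if i ∈ A then Measure.dirac (0 : ℝ) else volume) (s i)) (Finset.mem_univ x)]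
  simp only [Finset.mem_insert_self, if_true, Function.update_self, hx, if_false,
    measure_univ, one_mul]
  congr 1
  refine Finset.prod_congr rfl fun y hy => ?_
  have hyx : y ≠ x := Finset.ne_of_mem_erase hy
  simp [hyx]

/-- Existence of the energy minimizer among shifts of `v` by gradients of fields vanishing on
`A`, together with the Pythagorean identity. -/
lemma exists_energy_minimizer (A : Finset (Torus L)) (κ v : Edge L → ℝ) (hκ : ∀ b, 0 ≤ κ b) :
    ∃ m : Torus L → ℝ, (∀ x ∈ A, m x = 0) ∧
      ∀ u : Torus L → ℝ, (∀ x ∈ A, u x = 0) →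
        energy L κ (v + grad m + grad u) = energy L κ (v + grad m) + energy L κ (grad u) := by
  let U : Submodule ℝ (Torus L → ℝ) :=
    { carrier := {u | ∀ x ∈ A, u x = 0}
      add_mem' := fun {a b} ha hb x hx => by simp [ha x hx, hb x hx]
      zero_mem' := fun x _ => rfl
      smul_mem' := fun c a ha x hx => by simp [ha x hx] }
  let T : (Torus L → ℝ) →ₗ[ℝ] EuclideanSpace ℝ (Edge L) :=
    { toFun := fun φ => WithLp.toLp 2 fun b => √(κ b) * grad φ b
      map_add' := fun φ ψ => by ext b; simp [grad_add, mul_add]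
      map_smul' := fun c φ => by ext b; simp [grad_smul]; ring }
  let w : EuclideanSpace ℝ (Edge L) := WithLp.toLp 2 fun b => √(κ b) * v b
  obtain ⟨m', hm', hTm⟩ := Submodule.mem_map.1
    ((U.map T).starProjection_apply_mem w)
  refine ⟨-m', U.neg_mem hm', fun u hu => ?_⟩
  have horth : ∑ b, κ b * (v b + grad (-m') b) * grad u b = 0 := by
    have h := (U.map T).starProjection_inner_eq_zero w (T u) (Submodule.mem_map_of_mem hu)
    rw [← hTm, PiLp.inner_apply] at h
    rw [← h]
    refine Finset.sum_congr rfl fun b _ => ?_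
    have hn : grad (-m') b = - grad m' b := by simp only [grad, Pi.neg_apply]; ring
    simp only [T, w, LinearMap.coe_mk, AddHom.coe_mk, PiLp.sub_apply, hn]
    simp only [RCLike.inner_apply, conj_trivial]
    linear_combination (-(v b - grad m' b) * grad u b) * (Real.mul_self_sqrt (hκ b))
  have : ∑ b, κ b * (v + grad (-m') + grad u) b ^ 2 = ∑ b, κ b * (v + grad (-m')) b ^ 2
      + ∑ b, κ b * grad u b ^ 2 + 2 * ∑ b, κ b * (v b + grad (-m') b) * grad u b := by
    rw [Finset.mul_sum, ← Finset.sum_add_distrib, ← Finset.sum_add_distrib]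
    refine Finset.sum_congr rfl fun b _ => ?_
    simp only [Pi.add_apply]; ring
  unfold energy
  rw [this, horth]; ring

lemma energy_nonneg {κ : Edge L → ℝ} (hκ : ∀ b, 0 ≤ κ b) (η : Edge L → ℝ) : 0 ≤ energy L κ η :=
  mul_nonneg (by norm_num) (Finset.sum_nonneg fun b _ => mul_nonneg (hκ b) (sq_nonneg _))

/-- A Gaussian integral shifted by a fixed edge field equals the unshifted integral times the
Boltzmann factor of the energy minimizer. -/
lemma lintegral_boltzmann_shift (A : Finset (Torus L)) (κ v : Edge L → ℝ) (hκ : ∀ b, 0 ≤ κ b) :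
    ∃ m : Torus L → ℝ, (∀ x ∈ A, m x = 0) ∧ energy L κ (v + grad m) ≤ energy L κ v ∧
      ∫⁻ φ, boltzmann L κ (grad φ + v) ∂(pinnedMeasure L A) =
        boltzmann L κ (v + grad m) * pinnedZ L A κ := by
  obtain ⟨m, hm, hpyth⟩ := exists_energy_minimizer A κ v hκ
  refine ⟨m, hm, ?_, ?_⟩
  · have h := hpyth (-m) (fun x hx => by simp [hm x hx])
    have h0 : v + grad m + grad (-m) = v := by
      rw [add_assoc, ← grad_add]; ext b; simp [grad]
    have h1 := energy_nonneg hκ (grad (-m))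
    rw [h0] at h; linarith
  · have hmeas : Measurable fun φ : Torus L → ℝ => boltzmann L κ (grad φ + v) :=
      measurable_boltzmann_comp measurable_const (measurable_grad.add measurable_const)
    rw [← (pinnedMeasure_map_add A m hm).lintegral_comp hmeas, pinnedZ,
      ← lintegral_const_mul _ (measurable_boltzmann_comp measurable_const measurable_grad)]
    refine lintegral_congr_ae ?_
    filter_upwards [pinnedMeasure_ae_eq_zero A] with φ hφ
    have : grad (φ + m) + v = v + grad m + grad φ := by rw [grad_add]; abel
    rw [this]
    unfold boltzmann
    rw [hpyth φ hφ, neg_add, Real.exp_add, ENNReal.ofReal_mul (Real.exp_pos _).le]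

end Basic

lemma lintegral_pi_prod {ι : Type*} [Fintype ι] [DecidableEq ι] {X : ι → Type*}
    [∀ i, Nonempty (X i)] [∀ i, MeasurableSpace (X i)] (μ : ∀ i, Measure (X i)) [∀ i, SigmaFinite (μ i)]
    (f : ∀ i, X i → ℝ≥0∞) (hf : ∀ i, Measurable (f i)) :
    ∫⁻ x, ∏ i, f i (x i) ∂(Measure.pi μ) = ∏ i, ∫⁻ t, f i t ∂(μ i) := by
  have key : ∀ (s : Finset ι) (x : ∀ i, X i),
      lmarginal μ s (fun x => ∏ i ∈ s, f i (x i)) x = ∏ i ∈ s, ∫⁻ t, f i t ∂(μ i) := by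
    intro s
    induction s using Finset.induction_on with
    | empty => intro x; simp
    | insert a s ha ih =>
      intro x
      have hm : ∀ t : Finset ι, Measurable fun x : ∀ i, X i => ∏ i ∈ t, f i (x i) := fun t =>
        Finset.measurable_prod _ fun i _ => (hf i).comp (measurable_pi_apply i)
      rw [lmarginal_insert' _ (hm _) ha, Finset.prod_insert ha, ← ih x]
      have : (fun x : ∀ i, X i =>
          ∫⁻ t, ∏ i ∈ insert a s, f i (Function.update x a t i) ∂(μ a)) =
          fun x => (∫⁻ t, f a t ∂(μ a)) * ∏ i ∈ s, f i (x i) := by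
        ext x
        rw [← lintegral_mul_const _ (hf a)]
        refine lintegral_congr fun t => ?_
        rw [Finset.prod_insert ha, Function.update_self]
        congr 1
        refine Finset.prod_congr rfl fun i hi => ?_
        rw [Function.update_of_ne (ne_of_mem_of_not_mem hi ha)]
      rw [this]
      unfold lmarginal
      exact lintegral_const_mul _ ((hm s).comp measurable_updateFinset)
  rw [lintegral_eq_lmarginal_univ fun i => Classical.arbitrary (X i)]
  exact key _ _

/-- The one-dimensional Gaussian integral with exponent `-a t²`. -/
def gaussInt (a : ℝ) : ℝ≥0∞ := ∫⁻ t : ℝ, ENNReal.ofReal (Real.exp (-a * t ^ 2))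

lemma gaussInt_eq {a : ℝ} (ha : 0 < a) : gaussInt a = ENNReal.ofReal (√(π / a)) := by
  rw [gaussInt, ← ofReal_integral_eq_lintegral_ofReal (integrable_exp_neg_mul_sq ha)
    (ae_of_all _ fun t => (Real.exp_pos _).le), integral_gaussian]

section Pinning

variable {L : ℕ} [NeZero L]

lemma pinnedZ_eq_lintegral_insert (A : Finset (Torus L)) (x : Torus L) (hx : x ∉ A)
    (κ : Edge L → ℝ) :
    pinnedZ L A κ = ∫⁻ t : ℝ, ∫⁻ φ, boltzmann L κ (grad φ + grad (Pi.single x t))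
      ∂(pinnedMeasure L (insert x A)) := by
  have hmeas := measurable_update_pair x
  have hb : Measurable fun φ : Torus L → ℝ => boltzmann L κ (grad φ) :=
    measurable_boltzmann_comp measurable_const measurable_grad
  rw [pinnedZ, pinnedMeasure_eq_map_update A x hx, lintegral_map hb hmeas,
    lintegral_prod _ (by exact (hb.comp hmeas).aemeasurable)]
  refine lintegral_congr fun t => lintegral_congr_ae ?_
  filter_upwards [pinnedMeasure_ae_eq_zero (insert x A)] with φ hφ
  have h0 := hφ x (Finset.mem_insert_self _ _)
  have : Function.update φ x t = φ + Pi.single x t := by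
    ext y
    by_cases h : y = x
    · subst h; simp [h0]
    · simp [h]
  rw [this, grad_add]

lemma energy_grad_single_le {κ : Edge L → ℝ} {K : ℝ} (hK : ∀ b, κ b ≤ K) (hK0 : 0 ≤ K)
    (x : Torus L) (t : ℝ) : energy L κ (grad (Pi.single x t)) ≤ 4 * K * t ^ 2 := by
  have hpt : ∀ b : Edge L, κ b * grad (Pi.single x t) b ^ 2 ≤
      K * (2 * (Pi.single x t : Torus L → ℝ) (etarget b) ^ 2
        + 2 * (Pi.single x t : Torus L → ℝ) b.1 ^ 2) := by
    intro b
    refine (mul_le_mul_of_nonneg_right (hK b) (sq_nonneg _)).trans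
      (mul_le_mul_of_nonneg_left ?_ hK0)
    simp only [grad]
    nlinarith [sq_nonneg ((Pi.single x t : Torus L → ℝ) (etarget b)
      + (Pi.single x t : Torus L → ℝ) b.1)]
  have hs : ∑ y : Torus L, (Pi.single x t : Torus L → ℝ) y ^ 2 = t ^ 2 := by
    rw [Finset.sum_eq_single x (fun y _ h => by simp [h]) (by simp)]; simp
  have h1 : ∑ b : Edge L, (Pi.single x t : Torus L → ℝ) b.1 ^ 2 = 2 * t ^ 2 := by
    rw [Fintype.sum_prod_type_right]; simp only [Fintype.sum_bool, hs]; ring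
  have h2 : ∑ b : Edge L, (Pi.single x t : Torus L → ℝ) (etarget b) ^ 2 = 2 * t ^ 2 := by
    rw [Fintype.sum_prod_type_right]
    have : ∀ d : Bool, ∑ y : Torus L, (Pi.single x t : Torus L → ℝ) (etarget (y, d)) ^ 2
        = t ^ 2 := fun d => by
      rw [← hs]
      exact Equiv.sum_comp (Equiv.addRight (estep L d))
        fun y => (Pi.single x t : Torus L → ℝ) y ^ 2
    simp only [Fintype.sum_bool, this]; ring
  have := Finset.sum_le_sum fun b (_ : b ∈ Finset.univ) => hpt b
  rw [← Finset.mul_sum, Finset.sum_add_distrib, ← Finset.mul_sum, ← Finset.mul_sum, h1, h2] at this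
  unfold energy
  linarith

lemma boltzmann_le_of_le_energy {κ η : Edge L → ℝ} {c : ℝ} (h : c ≤ energy L κ η) :
    boltzmann L κ η ≤ ENNReal.ofReal (Real.exp (-c)) :=
  ENNReal.ofReal_le_ofReal (Real.exp_le_exp.2 (neg_le_neg h))

lemma le_boltzmann_of_energy_le {κ η : Edge L → ℝ} {c : ℝ} (h : energy L κ η ≤ c) :
    ENNReal.ofReal (Real.exp (-c)) ≤ boltzmann L κ η :=
  ENNReal.ofReal_le_ofReal (Real.exp_le_exp.2 (neg_le_neg h))

variable {κ : Edge L → ℝ} {κO κD : ℝ}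

lemma gaussInt_mul_pinnedZ_insert_le (hD : 0 < κD) (hκ : ∀ b, κD ≤ κ b ∧ κ b ≤ κO)
    (A : Finset (Torus L)) (x : Torus L) (hx : x ∉ A) :
    gaussInt (4 * κO) * pinnedZ L (insert x A) κ ≤ pinnedZ L A κ := by
  rw [pinnedZ_eq_lintegral_insert A x hx, gaussInt, ← lintegral_mul_const _ (by fun_prop)]
  refine lintegral_mono fun t => ?_
  obtain ⟨m, -, hle, heq⟩ := lintegral_boltzmann_shift (insert x A) κ (grad (Pi.single x t))
    fun b => hD.le.trans (hκ b).1
  rw [heq, neg_mul]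
  exact mul_le_mul_left (le_boltzmann_of_energy_le (hle.trans (energy_grad_single_le
    (fun b => (hκ b).2) (hD.le.trans ((hκ (0, true)).1.trans (hκ (0, true)).2)) x t))) _

lemma pinnedZ_le_gaussInt_mul_insert (hD : 0 < κD) (hκ : ∀ b, κD ≤ κ b ∧ κ b ≤ κO)
    (A : Finset (Torus L)) (x : Torus L) (hx : x ∉ A) (b : Edge L) (hb : etarget b = x)
    (hbA : b.1 ∈ A) :
    pinnedZ L A κ ≤ gaussInt (κD / 2) * pinnedZ L (insert x A) κ := by
  have hκ0 : ∀ b, 0 ≤ κ b := fun b => hD.le.trans (hκ b).1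
  rw [pinnedZ_eq_lintegral_insert A x hx, gaussInt, ← lintegral_mul_const _ (by fun_prop)]
  refine lintegral_mono fun t => ?_
  obtain ⟨m, hm, -, heq⟩ := lintegral_boltzmann_shift (insert x A) κ (grad (Pi.single x t)) hκ0
  rw [heq, neg_mul]
  refine mul_le_mul_left (boltzmann_le_of_le_energy ?_) _
  have hne : b.1 ≠ x := ne_of_mem_of_not_mem hbA hx
  have hval : (grad (Pi.single x t) + grad m) b = t := by
    simp [grad, hb, hm x (Finset.mem_insert_self _ _), hm b.1 (Finset.mem_insert_of_mem hbA), hne]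
  have := Finset.single_le_sum (f := fun b => κ b * (grad (Pi.single x t) + grad m) b ^ 2)
    (fun b _ => mul_nonneg (hκ0 b) (sq_nonneg _)) (Finset.mem_univ b)
  simp only [hval] at this
  unfold energy
  nlinarith [mul_le_mul_of_nonneg_right (hκ b).1 (sq_nonneg t)]

/-- The cost of pinning (or releasing) one site next to an already pinned one. -/
def pinCost (κO κD : ℝ) : ℝ≥0∞ := max 1 (max (gaussInt (κD / 2)) (gaussInt (4 * κO))⁻¹)

lemma one_le_pinCost : 1 ≤ pinCost κO κD := le_max_left _ _

lemma pinCost_ne_top (hD : 0 < κD) (hDO : κD ≤ κO) : pinCost κO κD ≠ ∞ := by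
  have hO : 0 < 4 * κO := by linarith
  have h2 : 0 < π / (4 * κO) := div_pos Real.pi_pos hO
  simp only [pinCost, gaussInt_eq (half_pos hD), gaussInt_eq hO]
  simp [h2]

/-- Pinning the sites of `A`, each of which is connected to the origin through `A`, costs at
most a constant factor per site. -/
lemma pinnedZ_compare (hD : 0 < κD) (hDO : κD ≤ κO) (hκ : ∀ b, κD ≤ κ b ∧ κ b ≤ κO)
    (r : Torus L → ℕ) (A : Finset (Torus L))
    (hA : ∀ x ∈ A, x ≠ 0 → ∃ b : Edge L, etarget b = x ∧ (b.1 = 0 ∨ b.1 ∈ A ∧ r b.1 < r x)) :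
    pinnedZ L {0} κ ≤ pinCost κO κD ^ A.card * pinnedZ L (insert 0 A) κ ∧
      pinnedZ L (insert 0 A) κ ≤ pinCost κO κD ^ A.card * pinnedZ L {0} κ := by
  induction A using Finset.induction_on_max_value r with
  | empty => simp
  | insert a s ha hmax ih =>
    have hs := ih fun x hx hx0 => by
      obtain ⟨b, hb, h⟩ := hA x (Finset.mem_insert_of_mem hx) hx0
      refine ⟨b, hb, h.imp id fun ⟨h1, h2⟩ => ⟨(Finset.mem_insert.1 h1).resolve_left ?_, h2⟩⟩
      intro h; rw [h] at h2; exact absurd (hmax x hx) (by omega)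
    rw [Finset.card_insert_of_notMem ha, pow_succ]
    have hstep : pinnedZ L (insert 0 s) κ ≤
          pinCost κO κD * pinnedZ L (insert 0 (insert a s)) κ ∧
        pinnedZ L (insert 0 (insert a s)) κ ≤ pinCost κO κD * pinnedZ L (insert 0 s) κ := by
      by_cases h0 : a = 0
      · subst h0
        rw [Finset.insert_idem]
        exact ⟨le_mul_of_one_le_left' one_le_pinCost, le_mul_of_one_le_left' one_le_pinCost⟩
      · rw [Finset.insert_comm]
        have hx : a ∉ insert 0 s := by simp [h0, ha]
        obtain ⟨b, hb, h⟩ := hA a (Finset.mem_insert_self _ _) h0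
        have hbA : b.1 ∈ insert 0 s := by
          rcases h with h | ⟨h1, h2⟩
          · simp [h]
          · refine Finset.mem_insert_of_mem ((Finset.mem_insert.1 h1).resolve_left ?_)
            intro h; rw [h] at h2; exact lt_irrefl _ h2
        have hO : 0 < 4 * κO := by linarith
        have hG : gaussInt (4 * κO) ≠ 0 := by
          rw [gaussInt_eq hO]; simpa using Real.sqrt_pos.2 (div_pos Real.pi_pos hO)
        have hG' : gaussInt (4 * κO) ≠ ∞ := by rw [gaussInt_eq hO]; simp
        refine ⟨(pinnedZ_le_gaussInt_mul_insert hD hκ _ a hx b hb hbA).trans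
          (mul_le_mul_left ((le_max_left _ _).trans (le_max_right _ _)) _), ?_⟩
        refine le_trans ?_ (mul_le_mul_left ((le_max_right _ _).trans (le_max_right _ _)) _)
        rw [mul_comm, ← div_eq_mul_inv, ENNReal.le_div_iff_mul_le (Or.inl hG) (Or.inl hG'), mul_comm]
        exact gaussInt_mul_pinnedZ_insert_le hD hκ _ a hx
    constructor
    · rw [mul_assoc]
      exact hs.1.trans (mul_le_mul_right hstep.1 _)
    · rw [mul_comm (_ ^ _), mul_assoc]
      exact hstep.2.trans (mul_le_mul_right hs.2 _)

end Pinning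

lemma avgPinnedZ_le_of_pinnedZ_le {L : ℕ} [NeZero L] {κO κD : ℝ} {ρ : Measure ℝ} [SigmaFinite ρ]
    (hρ : ∀ᵐ t ∂ρ, κD ≤ t ∧ t ≤ κO) {A B : Finset (Torus L)} {C : ℝ≥0∞} (hC : C ≠ ∞)
    (h : ∀ κ : Edge L → ℝ, (∀ b, κD ≤ κ b ∧ κ b ≤ κO) → pinnedZ L A κ ≤ C * pinnedZ L B κ) :
    avgPinnedZ L A ρ ≤ C * avgPinnedZ L B ρ := by
  have hae : ∀ᵐ κ ∂(rhoL L ρ), ∀ b, κD ≤ κ b ∧ κ b ≤ κO :=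
    ae_all_iff.2 fun b =>
      (Measure.tendsto_eval_ae_ae (μ := fun _ : Edge L => ρ) (i := b)).eventually hρ
  unfold avgPinnedZ
  rw [← lintegral_const_mul' _ _ hC]
  exact lintegral_mono_ae (hae.mono fun κ hκ => h κ hκ)

/-- The sites having a coordinate divisible by `M`. -/
def grid (L M : ℕ) [NeZero L] : Finset (Torus L) :=
  Finset.univ.filter fun x => (x.1.val : ZMod M) = 0 ∨ (x.2.val : ZMod M) = 0

lemma zmod_val_sub_one_lt {L : ℕ} [NeZero L] {a : ZMod L} (ha : a ≠ 0) :
    (a - 1).val < a.val := by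
  have h0 : a.val ≠ 0 := fun h => ha ((ZMod.val_eq_zero a).1 h)
  have h1 : a - 1 = ((a.val - 1 : ℕ) : ZMod L) := by
    rw [Nat.cast_sub (Nat.one_le_iff_ne_zero.2 h0), ZMod.natCast_zmod_val, Nat.cast_one]
  have := ZMod.val_lt a
  rw [h1, ZMod.val_natCast_of_lt (by omega)]
  omega

lemma grid_connected (L M : ℕ) [NeZero L] (x : Torus L) (hx : x ∈ grid L M) (hx0 : x ≠ 0) :
    ∃ b : Edge L, etarget b = x ∧
      (b.1 = 0 ∨ b.1 ∈ grid L M ∧ b.1.1.val + b.1.2.val < x.1.val + x.2.val) := by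
  obtain ⟨a, c⟩ := x
  simp only [grid, Finset.mem_filter, Finset.mem_univ, true_and] at hx ⊢
  by_cases hc : c = 0
  · subst hc
    have ha : a ≠ 0 := fun h => hx0 (by simp [h])
    refine ⟨((a - 1, 0), true), by simp [etarget, estep], Or.inr ⟨Or.inr (by simp), ?_⟩⟩
    simpa using zmod_val_sub_one_lt ha
  · by_cases hM : (a.val : ZMod M) = 0
    · refine ⟨((a, c - 1), false), by simp [etarget, estep], Or.inr ⟨Or.inl hM, ?_⟩⟩
      simpa using zmod_val_sub_one_lt hc
    · have ha : a ≠ 0 := fun h => hM (by simp [h])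
      refine ⟨((a - 1, c), true), by simp [etarget, estep],
        Or.inr ⟨Or.inr (hx.resolve_left hM), ?_⟩⟩
      simpa using zmod_val_sub_one_lt ha

lemma zero_mem_grid (L M : ℕ) [NeZero L] : (0 : Torus L) ∈ grid L M := by simp [grid]

lemma avgPinnedZ_grid_compare (L M : ℕ) [NeZero L] {κO κD : ℝ} (hD : 0 < κD) (hDO : κD ≤ κO)
    {ρ : Measure ℝ} [SigmaFinite ρ] (hρ : ∀ᵐ t ∂ρ, κD ≤ t ∧ t ≤ κO) :
    avgPinnedZ L {0} ρ ≤ pinCost κO κD ^ (grid L M).card * avgPinnedZ L (grid L M) ρ ∧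
      avgPinnedZ L (grid L M) ρ ≤ pinCost κO κD ^ (grid L M).card * avgPinnedZ L {0} ρ := by
  have hC : pinCost κO κD ^ (grid L M).card ≠ ∞ := ENNReal.pow_ne_top (pinCost_ne_top hD hDO)
  have h := fun κ hκ => pinnedZ_compare (κ := κ) hD hDO hκ (fun x => x.1.val + x.2.val)
    (grid L M) (grid_connected L M)
  rw [Finset.insert_eq_of_mem (zero_mem_grid L M)] at h
  exact ⟨avgPinnedZ_le_of_pinnedZ_le hρ hC fun κ hκ => (h κ hκ).1,
    avgPinnedZ_le_of_pinnedZ_le hρ hC fun κ hκ => (h κ hκ).2⟩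

lemma avgPinnedZ_univ (L : ℕ) [NeZero L] (ρ : Measure ℝ) [IsProbabilityMeasure ρ] :
    avgPinnedZ L Finset.univ ρ = 1 := by
  have : ∀ κ, pinnedZ L Finset.univ κ = 1 := by
    intro κ
    have hμ : IsProbabilityMeasure (pinnedMeasure L Finset.univ) := by
      unfold pinnedMeasure; simp only [Finset.mem_univ, if_true]; infer_instance
    have : ∫⁻ φ, boltzmann L κ (grad φ) ∂(pinnedMeasure L Finset.univ)
        = ∫⁻ _, 1 ∂(pinnedMeasure L Finset.univ) := by
      refine lintegral_congr_ae ?_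
      filter_upwards [pinnedMeasure_ae_eq_zero Finset.univ] with φ hφ
      simp [boltzmann, energy, grad, hφ]
    rw [pinnedZ, this]; simp
  have hρ : IsProbabilityMeasure (rhoL L ρ) := by unfold rhoL; infer_instance
  simp [avgPinnedZ, this]

lemma grid_one (L : ℕ) [NeZero L] : grid L 1 = Finset.univ := by
  ext x; simp [grid, Subsingleton.elim _ (0 : ZMod 1)]

lemma avgPinnedZ_zero_ne (L : ℕ) [NeZero L] {κO κD : ℝ} (hD : 0 < κD) (hDO : κD ≤ κO)
    {ρ : Measure ℝ} [IsProbabilityMeasure ρ] (hρ : ∀ᵐ t ∂ρ, κD ≤ t ∧ t ≤ κO) :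
    avgPinnedZ L {0} ρ ≠ 0 ∧ avgPinnedZ L {0} ρ ≠ ∞ := by
  have h := avgPinnedZ_grid_compare L 1 hD hDO hρ
  rw [grid_one, avgPinnedZ_univ] at h
  have hC : pinCost κO κD ^ (Finset.univ : Finset (Torus L)).card ≠ ∞ :=
    ENNReal.pow_ne_top (pinCost_ne_top hD hDO)
  refine ⟨fun h0 => ?_, ne_top_of_le_ne_top (by simpa using hC) h.1⟩
  rw [h0] at h; simp at h

section Blocks

variable (k M : ℕ) [NeZero k] [NeZero M]

/-- The position of a coordinate: its block and its residue within the block. -/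
def splitCoord (a : ZMod (k * M)) : Fin k × ZMod M :=
  (⟨a.val / M, Nat.div_lt_of_lt_mul ((ZMod.val_lt a).trans_eq (mul_comm _ _))⟩, (a.val : ZMod M))

lemma splitCoord_bijective : Function.Bijective (splitCoord k M) := by
  rw [Fintype.bijective_iff_injective_and_card]
  refine ⟨fun a b h => ?_, by simp [ZMod.card]⟩
  simp only [splitCoord, Prod.mk.injEq, Fin.mk.injEq, ZMod.natCast_eq_natCast_iff'] at h
  apply ZMod.val_injective
  rw [← Nat.div_add_mod a.val M, ← Nat.div_add_mod b.val M, h.1, h.2]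

lemma splitCoord_snd_add_one (a : ZMod (k * M)) :
    (splitCoord k M (a + 1)).2 = (splitCoord k M a).2 + 1 := by
  have h (c : ZMod (k * M)) : (c.val : ZMod M) = ZMod.castHom (Dvd.intro_left k rfl) (ZMod M) c := by
    rw [ZMod.castHom_apply, ZMod.natCast_val]
  simp only [splitCoord, h, map_add, map_one]

lemma splitCoord_fst_add_one (a : ZMod (k * M)) :
    (splitCoord k M (a + 1)).1 = (splitCoord k M a).1 ∨ (splitCoord k M (a + 1)).2 = 0 := by
  by_cases h : (splitCoord k M (a + 1)).2 = 0
  · exact Or.inr h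
  · left
    simp only [splitCoord, ZMod.natCast_eq_zero_iff, Fin.mk.injEq] at h ⊢
    have hne : a + 1 ≠ 0 := fun h0 => h (by simp [h0])
    have hval : (a + 1).val = a.val + 1 := by
      have h1 := zmod_val_sub_one_lt hne
      rw [add_sub_cancel_right] at h1
      have h2 := ZMod.val_add_le a 1
      have h3 : (1 : ZMod (k * M)).val ≤ 1 := by
        rw [ZMod.val_one_eq_one_mod]; exact Nat.mod_le _ _
      omega
    rw [hval] at h ⊢
    rw [Nat.succ_div, if_neg h, add_zero]

/-- Sites of the large torus correspond to pairs of a block and a site of the small torus. -/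
def splitSite : Torus (k * M) ≃ (Fin k × Fin k) × Torus M :=
  ((Equiv.ofBijective _ (splitCoord_bijective k M)).prodCongr
    (Equiv.ofBijective _ (splitCoord_bijective k M))).trans (Equiv.prodProdProdComm _ _ _ _)

lemma splitSite_apply (x : Torus (k * M)) : splitSite k M x =
    (((splitCoord k M x.1).1, (splitCoord k M x.2).1),
      ((splitCoord k M x.1).2, (splitCoord k M x.2).2)) := rfl

lemma mem_grid_mul_iff (x : Torus (k * M)) :
    x ∈ grid (k * M) M ↔ (splitSite k M x).2 ∈ grid M M := by
  simp [grid, splitSite_apply, splitCoord]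

lemma splitSite_etarget (b : Edge (k * M)) :
    (splitSite k M (etarget b)).2 = (splitSite k M b.1).2 + estep M b.2 ∧
    ((splitSite k M (etarget b)).1 = (splitSite k M b.1).1 ∨
      (splitSite k M (etarget b)).2 ∈ grid M M) := by
  obtain ⟨⟨a, c⟩, d⟩ := b
  cases d
  · simp only [etarget, estep, splitSite_apply, Prod.mk_add_mk, add_zero, Bool.false_eq_true,
      if_false, splitCoord_snd_add_one, true_and]
    refine (splitCoord_fst_add_one k M c).imp (fun h => by rw [h]) fun h => ?_
    rw [splitCoord_snd_add_one] at h
    simp [grid, h]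
  · simp only [etarget, estep, splitSite_apply, Prod.mk_add_mk, add_zero,
      if_true, splitCoord_snd_add_one, true_and]
    refine (splitCoord_fst_add_one k M a).imp (fun h => by rw [h]) fun h => ?_
    rw [splitCoord_snd_add_one] at h
    simp [grid, h]

lemma card_grid_self_le : (grid M M).card ≤ 2 * M := by
  have : grid M M ⊆ (Finset.univ.image fun a : ZMod M => ((0, a) : Torus M)) ∪
      (Finset.univ.image fun a : ZMod M => ((a, 0) : Torus M)) := by
    rintro ⟨a, c⟩ h
    simp only [grid, Finset.mem_filter, Finset.mem_univ, true_and, ZMod.natCast_zmod_val] at h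
    rcases h with rfl | rfl <;> simp
  refine (Finset.card_le_card this).trans ((Finset.card_union_le _ _).trans ?_)
  have h1 : (Finset.univ : Finset (ZMod M)).card = M := by simp [ZMod.card]
  have := Finset.card_image_le (s := Finset.univ) (f := fun a : ZMod M => ((0, a) : Torus M))
  have := Finset.card_image_le (s := Finset.univ) (f := fun a : ZMod M => ((a, 0) : Torus M))
  omega

lemma card_grid_mul_le : (grid (k * M) M).card ≤ k ^ 2 * (2 * M) := by
  have : (grid (k * M) M).map (splitSite k M).toEmbedding = Finset.univ ×ˢ grid M M := by
    ext y
    obtain ⟨x, rfl⟩ := (splitSite k M).surjective y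
    simp [mem_grid_mul_iff]
  rw [← Finset.card_map (splitSite k M).toEmbedding, this, Finset.card_product]
  simp only [Finset.card_univ, Fintype.card_prod, Fintype.card_fin, ← sq]
  exact Nat.mul_le_mul_left _ (card_grid_self_le M)

lemma pinnedMeasure_grid_mul :
    pinnedMeasure (k * M) (grid (k * M) M) = Measure.map
      (fun (Ψ : Fin k × Fin k → Torus M → ℝ) x => Ψ (splitSite k M x).1 (splitSite k M x).2)
      (Measure.pi fun _ => pinnedMeasure M (grid M M)) := by
  have hmeas : Measurable fun (Ψ : Fin k × Fin k → Torus M → ℝ) (x : Torus (k * M)) =>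
      Ψ (splitSite k M x).1 (splitSite k M x).2 := by fun_prop
  refine Measure.pi_eq fun s hs => ?_
  rw [Measure.map_apply hmeas (MeasurableSet.univ_pi hs)]
  have : (fun (Ψ : Fin k × Fin k → Torus M → ℝ) (x : Torus (k * M)) =>
      Ψ (splitSite k M x).1 (splitSite k M x).2) ⁻¹' (Set.univ.pi s) =
      Set.univ.pi fun B => Set.univ.pi fun y => s ((splitSite k M).symm (B, y)) := by
    ext Ψ
    simp only [Set.mem_preimage, Set.mem_pi, Set.mem_univ, true_imp_iff]
    constructor
    · intro h B y
      simpa using h ((splitSite k M).symm (B, y))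
    · intro h x
      simpa using h (splitSite k M x).1 (splitSite k M x).2
  rw [this, Measure.pi_pi]
  simp only [pinnedMeasure, Measure.pi_pi]
  rw [← Fintype.prod_prod_type' (f := fun B y => (if y ∈ grid M M then Measure.dirac (0 : ℝ)
    else volume) (s ((splitSite k M).symm (B, y)))), ← (splitSite k M).prod_comp]
  refine Finset.prod_congr rfl fun x _ => ?_
  simp [mem_grid_mul_iff]

end Blocks

/-- The annealed weight of a single edge. -/
def edgeWeight (ρ : Measure ℝ) (η : ℝ) : ℝ≥0∞ :=
  ∫⁻ t, ENNReal.ofReal (Real.exp (-(1 / 2 * (t * η ^ 2)))) ∂ρ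

lemma measurable_edgeWeight (ρ : Measure ℝ) [SFinite ρ] : Measurable (edgeWeight ρ) := by
  unfold edgeWeight
  exact Measurable.lintegral_prod_right' (f := fun q : ℝ × ℝ =>
    ENNReal.ofReal (Real.exp (-(1 / 2 * (q.2 * q.1 ^ 2))))) (by fun_prop)

lemma avgPinnedZ_eq_lintegral_edgeWeight {L : ℕ} [NeZero L] (A : Finset (Torus L))
    (ρ : Measure ℝ) [SigmaFinite ρ] :
    avgPinnedZ L A ρ = ∫⁻ φ, ∏ b, edgeWeight ρ (grad φ b) ∂(pinnedMeasure L A) := by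
  have : SigmaFinite (rhoL L ρ) := by unfold rhoL; infer_instance
  unfold avgPinnedZ pinnedZ
  rw [lintegral_lintegral_swap (measurable_boltzmann_comp measurable_fst
    (measurable_grad.comp measurable_snd)).aemeasurable]
  refine lintegral_congr fun φ => ?_
  have h := lintegral_pi_prod (fun _ : Edge L => ρ) (fun b t =>
    ENNReal.ofReal (Real.exp (-(1 / 2 * (t * grad φ b ^ 2))))) (fun b => by fun_prop)
  unfold edgeWeight rhoL
  rw [← h]
  refine lintegral_congr fun κ => ?_
  rw [← ENNReal.ofReal_prod_of_nonneg fun b _ => (Real.exp_pos _).le, ← Real.exp_sum, boltzmann,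
    energy, Finset.sum_neg_distrib, Finset.mul_sum]

/-- Pinning the block boundaries makes the partition function factorize. -/
lemma avgPinnedZ_grid_mul (k M : ℕ) [NeZero k] [NeZero M] (ρ : Measure ℝ) [SigmaFinite ρ] :
    avgPinnedZ (k * M) (grid (k * M) M) ρ = avgPinnedZ M (grid M M) ρ ^ (k ^ 2) := by
  have hw : ∀ L : ℕ, [NeZero L] → Measurable fun φ : Torus L → ℝ =>
      ∏ b, edgeWeight ρ (grad φ b) := fun L _ =>
    Finset.measurable_prod _ fun b _ =>
      (measurable_edgeWeight ρ).comp ((measurable_pi_apply b).comp measurable_grad)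
  rw [avgPinnedZ_eq_lintegral_edgeWeight, avgPinnedZ_eq_lintegral_edgeWeight,
    pinnedMeasure_grid_mul, lintegral_map (hw _) (by fun_prop)]
  have hfac := lintegral_pi_prod (fun _ : Fin k × Fin k => pinnedMeasure M (grid M M))
    (fun _ φ => ∏ b, edgeWeight ρ (grad φ b)) (fun _ => hw M)
  rw [Finset.prod_const, Finset.card_univ, Fintype.card_prod, Fintype.card_fin, ← sq] at hfac
  rw [← hfac]
  have hae : ∀ᵐ Ψ ∂(Measure.pi fun _ : Fin k × Fin k => pinnedMeasure M (grid M M)),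
      ∀ B, ∀ y ∈ grid M M, Ψ B y = 0 :=
    ae_all_iff.2 fun B => (Measure.tendsto_eval_ae_ae
      (μ := fun _ : Fin k × Fin k => pinnedMeasure M (grid M M)) (i := B)).eventually
        (pinnedMeasure_ae_eq_zero (grid M M))
  refine lintegral_congr_ae ?_
  filter_upwards [hae] with Ψ hΨ
  rw [← Fintype.prod_prod_type' (f := fun B b => edgeWeight ρ (grad (Ψ B) b)),
    ← (((splitSite k M).prodCongr (Equiv.refl Bool)).trans (Equiv.prodAssoc _ _ _)).prod_comp]
  refine Finset.prod_congr rfl fun b _ => ?_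
  have hb := splitSite_etarget k M b
  congr 1
  simp only [grad, Equiv.trans_apply, Equiv.prodCongr_apply, Prod.map, Equiv.refl_apply,
    Equiv.prodAssoc_apply]
  congr 1
  change _ = Ψ _ ((splitSite k M b.1).2 + estep M b.2)
  rw [← hb.1]
  rcases hb.2 with h | h
  · rw [h]
  · rw [hΨ _ _ h, hΨ _ _ h]

lemma nuL_eq_map_grad (L : ℕ) [NeZero L] :
    nuL L = Measure.map grad (pinnedMeasure L {0}) := by
  unfold nuL
  congr 1
  symm
  have hmeas : Measurable (fun ψ : {x : Torus L // x ≠ 0} → ℝ => fun x : Torus L =>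
      if h : x = 0 then (0 : ℝ) else ψ ⟨x, h⟩) := by
    refine measurable_pi_iff.2 fun x => ?_
    by_cases h : x = 0
    · simp [h]
    · simpa [h] using measurable_pi_apply _
  refine Measure.pi_eq fun s hs => ?_
  rw [Measure.map_apply hmeas (MeasurableSet.univ_pi hs),
    ← Finset.mul_prod_erase _ _ (Finset.mem_univ (0 : Torus L))]
  have hprod : ∏ x ∈ Finset.univ.erase (0 : Torus L),
      (if x ∈ ({0} : Finset (Torus L)) then Measure.dirac (0 : ℝ) else volume) (s x) =
      ∏ x : {x : Torus L // x ≠ 0}, volume (s x) := by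
    rw [← Finset.prod_subtype (Finset.univ.erase (0 : Torus L)) (by simp)
      (fun x => volume (s x))]
    refine Finset.prod_congr rfl fun x hx => ?_
    simp [Finset.ne_of_mem_erase hx]
  rw [hprod]
  simp only [Finset.mem_singleton, if_true, Measure.dirac_apply' _ (hs 0)]
  by_cases h0 : (0 : ℝ) ∈ s 0
  · have : (fun ψ : {x : Torus L // x ≠ 0} → ℝ => fun x : Torus L =>
        if h : x = 0 then (0 : ℝ) else ψ ⟨x, h⟩) ⁻¹' (Set.univ.pi s) =
        Set.univ.pi fun x : {x : Torus L // x ≠ 0} => s x := by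
      ext ψ
      simp only [Set.mem_preimage, Set.mem_pi, Set.mem_univ, true_imp_iff]
      constructor
      · intro h x
        simpa [x.2] using h x
      · intro h x
        by_cases hx : x = 0
        · subst hx; simpa using h0
        · simpa [hx] using h ⟨x, hx⟩
    rw [this, volume_pi_pi]; simp [h0]
  · have : (fun ψ : {x : Torus L // x ≠ 0} → ℝ => fun x : Torus L =>
        if h : x = 0 then (0 : ℝ) else ψ ⟨x, h⟩) ⁻¹' (Set.univ.pi s) = ∅ := by
      ext ψ
      simp only [Set.mem_preimage, Set.mem_pi, Set.mem_univ, true_imp_iff,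
        Set.mem_empty_iff_false, iff_false]
      intro h
      exact h0 (by simpa using h 0)
    rw [this]; simp [h0]

/-- The constant edge field with horizontal and vertical slopes `s / L²` and `t / L²`. -/
def tilt (L : ℕ) (q : ℝ × ℝ) (b : Edge L) : ℝ := (if b.2 then q.1 else q.2) / (L : ℝ) ^ 2

lemma measurable_tilt {L : ℕ} : Measurable fun q : ℝ × ℝ => tilt L q := by
  refine measurable_pi_iff.2 fun b => ?_
  unfold tilt
  split_ifs <;> fun_prop

section Star

variable {L : ℕ} [NeZero L]

lemma ZLV_eq_avgPinnedZ (ρ : Measure ℝ) [SigmaFinite ρ] : ZLV L ρ = avgPinnedZ L {0} ρ := by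
  have : SigmaFinite (rhoL L ρ) := by unfold rhoL; infer_instance
  have : SFinite (nuL L) := by rw [nuL_eq_map_grad]; infer_instance
  change ∫⁻ x, boltzmann L x.2 x.1 ∂((nuL L).prod (rhoL L ρ)) = _
  rw [lintegral_prod_symm' _ (measurable_boltzmann_comp measurable_snd measurable_fst),
    avgPinnedZ]
  refine lintegral_congr fun κ => ?_
  change ∫⁻ η, boltzmann L κ η ∂(nuL L) = _
  rw [nuL_eq_map_grad, lintegral_map (measurable_boltzmann κ) measurable_grad, pinnedZ]

/-- The tilted partition function for fixed bond weights. -/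
def tiltedZ (L : ℕ) [NeZero L] (κ : Edge L → ℝ) : ℝ≥0∞ :=
  ∫⁻ q : ℝ × ℝ, ∫⁻ φ, boltzmann L κ (grad φ + tilt L q) ∂(pinnedMeasure L {0})

lemma ZLVstar_eq_lintegral_tiltedZ (ρ : Measure ℝ) [SigmaFinite ρ] :
    ZLVstar L ρ = ∫⁻ κ, tiltedZ L κ ∂(rhoL L ρ) := by
  have : SigmaFinite (rhoL L ρ) := by unfold rhoL; infer_instance
  have : SFinite (nuL L) := by rw [nuL_eq_map_grad]; infer_instance
  have hadd : Measurable fun q : (Edge L → ℝ) × (ℝ × ℝ) => q.1 + tilt L q.2 :=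
    measurable_fst.add (measurable_tilt.comp measurable_snd)
  have hstar : nuStar L = Measure.map (fun q : (Edge L → ℝ) × (ℝ × ℝ) => q.1 + tilt L q.2)
    ((nuL L).prod volume) := rfl
  have : SFinite (nuStar L) := by rw [hstar]; infer_instance
  change ∫⁻ x, boltzmann L x.2 x.1 ∂((nuStar L).prod (rhoL L ρ)) = _
  rw [lintegral_prod_symm' _ (measurable_boltzmann_comp measurable_snd measurable_fst)]
  refine lintegral_congr fun κ => ?_
  change ∫⁻ η, boltzmann L κ η ∂(nuStar L) = _
  rw [hstar, lintegral_map (measurable_boltzmann κ) hadd,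
    lintegral_prod_symm' _ (measurable_boltzmann_comp measurable_const hadd), tiltedZ]
  refine lintegral_congr fun q => ?_
  have hshift : Measurable fun η : Edge L → ℝ => boltzmann L κ (η + tilt L q) :=
    measurable_boltzmann_comp measurable_const (measurable_id.add measurable_const)
  rw [nuL_eq_map_grad, lintegral_map hshift measurable_grad]

lemma sum_tilt_sq (q : ℝ × ℝ) :
    ∑ b : Edge L, tilt L q b ^ 2 = (q.1 ^ 2 + q.2 ^ 2) / (L : ℝ) ^ 2 := by
  have hL : (L : ℝ) ≠ 0 := Nat.cast_ne_zero.2 (NeZero.ne L)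
  rw [Fintype.sum_prod_type]
  simp only [tilt, Fintype.sum_bool, if_true, Bool.false_eq_true, if_false, Finset.sum_const,
    Finset.card_univ, Fintype.card_prod, ZMod.card, nsmul_eq_mul]
  push_cast
  field_simp

lemma sum_grad_of_direction (φ : Torus L → ℝ) (d : Bool) : ∑ x : Torus L, grad φ (x, d) = 0 := by
  simp only [grad, Finset.sum_sub_distrib]
  rw [sub_eq_zero]
  exact Equiv.sum_comp (Equiv.addRight (estep L d)) φ

lemma sum_tilt_sq_le (q : ℝ × ℝ) (m : Torus L → ℝ) :
    ∑ b : Edge L, tilt L q b ^ 2 ≤ ∑ b : Edge L, (tilt L q + grad m) b ^ 2 := by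
  have hcross : ∑ b : Edge L, tilt L q b * grad m b = 0 := by
    rw [Fintype.sum_prod_type_right]
    simp only [tilt, Fintype.sum_bool, if_true, Bool.false_eq_true, if_false, ← Finset.mul_sum,
      sum_grad_of_direction, mul_zero, add_zero]
  have : ∑ b : Edge L, (tilt L q + grad m) b ^ 2 = ∑ b, tilt L q b ^ 2 + ∑ b, grad m b ^ 2
      + 2 * ∑ b, tilt L q b * grad m b := by
    rw [Finset.mul_sum, ← Finset.sum_add_distrib, ← Finset.sum_add_distrib]
    refine Finset.sum_congr rfl fun b _ => ?_
    simp only [Pi.add_apply]; ring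
  rw [this, hcross]
  have := Finset.sum_nonneg fun b (_ : b ∈ (Finset.univ : Finset (Edge L))) => sq_nonneg (grad m b)
  linarith

lemma lintegral_gauss_two {c : ℝ} :
    ∫⁻ q : ℝ × ℝ, ENNReal.ofReal (Real.exp (-(c * (q.1 ^ 2 + q.2 ^ 2)))) = gaussInt c ^ 2 := by
  rw [sq, gaussInt, Measure.volume_eq_prod, ← lintegral_prod_mul (by fun_prop) (by fun_prop)]
  refine lintegral_congr fun q => ?_
  rw [← ENNReal.ofReal_mul (Real.exp_pos _).le, ← Real.exp_add]
  congr 2; ring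

variable {κ : Edge L → ℝ} {κO κD : ℝ}

lemma tiltedZ_le (hD : 0 < κD) (hκ : ∀ b, κD ≤ κ b ∧ κ b ≤ κO) :
    tiltedZ L κ ≤ gaussInt (κD / (2 * (L : ℝ) ^ 2)) ^ 2 * pinnedZ L {0} κ := by
  have hκ0 : ∀ b, 0 ≤ κ b := fun b => hD.le.trans (hκ b).1
  rw [tiltedZ, ← lintegral_gauss_two, ← lintegral_mul_const _ (by fun_prop)]
  refine lintegral_mono fun q => ?_
  obtain ⟨m, -, -, heq⟩ := lintegral_boltzmann_shift {0} κ (tilt L q) hκ0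
  rw [heq]
  refine mul_le_mul_left (boltzmann_le_of_le_energy ?_) _
  have h1 : κD * ∑ b, (tilt L q + grad m) b ^ 2 ≤ ∑ b, κ b * (tilt L q + grad m) b ^ 2 := by
    rw [Finset.mul_sum]
    exact Finset.sum_le_sum fun b _ => mul_le_mul_of_nonneg_right (hκ b).1 (sq_nonneg _)
  have h2 := mul_le_mul_of_nonneg_left (sum_tilt_sq_le q m) hD.le
  rw [sum_tilt_sq] at h2
  unfold energy
  calc κD / (2 * (L : ℝ) ^ 2) * (q.1 ^ 2 + q.2 ^ 2)
      = 1 / 2 * (κD * ((q.1 ^ 2 + q.2 ^ 2) / (L : ℝ) ^ 2)) := by ring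
    _ ≤ _ := by linarith

lemma le_tiltedZ (hD : 0 < κD) (hκ : ∀ b, κD ≤ κ b ∧ κ b ≤ κO) :
    gaussInt (κO / (2 * (L : ℝ) ^ 2)) ^ 2 * pinnedZ L {0} κ ≤ tiltedZ L κ := by
  have hκ0 : ∀ b, 0 ≤ κ b := fun b => hD.le.trans (hκ b).1
  rw [tiltedZ, ← lintegral_gauss_two, ← lintegral_mul_const _ (by fun_prop)]
  refine lintegral_mono fun q => ?_
  obtain ⟨m, -, hle, heq⟩ := lintegral_boltzmann_shift {0} κ (tilt L q) hκ0
  rw [heq]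
  refine mul_le_mul_left (le_boltzmann_of_energy_le (hle.trans ?_)) _
  have h1 : ∑ b, κ b * tilt L q b ^ 2 ≤ κO * ∑ b, tilt L q b ^ 2 := by
    rw [Finset.mul_sum]
    exact Finset.sum_le_sum fun b _ => mul_le_mul_of_nonneg_right (hκ b).2 (sq_nonneg _)
  rw [sum_tilt_sq] at h1
  unfold energy
  calc _ ≤ 1 / 2 * (κO * ((q.1 ^ 2 + q.2 ^ 2) / (L : ℝ) ^ 2)) := by linarith
    _ = _ := by ring

lemma gaussInt_tilt_sq {c : ℝ} (hc : 0 < c) :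
    gaussInt (c / (2 * (L : ℝ) ^ 2)) ^ 2 = ENNReal.ofReal (2 * π / c * (L : ℝ) ^ 2) := by
  have hL : 0 < (L : ℝ) := Nat.cast_pos.2 (NeZero.pos L)
  have h : 0 < c / (2 * (L : ℝ) ^ 2) := by positivity
  rw [gaussInt_eq h, ← ENNReal.ofReal_pow (Real.sqrt_nonneg _), Real.sq_sqrt (by positivity)]
  congr 1; field_simp

lemma ZLVstar_bounds (hD : 0 < κD) (hDO : κD ≤ κO) {ρ : Measure ℝ} [SigmaFinite ρ]
    (hρ : ∀ᵐ t ∂ρ, κD ≤ t ∧ t ≤ κO) :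
    ENNReal.ofReal (2 * π / κO * (L : ℝ) ^ 2) * ZLV L ρ ≤ ZLVstar L ρ ∧
      ZLVstar L ρ ≤ ENNReal.ofReal (2 * π / κD * (L : ℝ) ^ 2) * ZLV L ρ := by
  have hae : ∀ᵐ κ ∂(rhoL L ρ), ∀ b, κD ≤ κ b ∧ κ b ≤ κO :=
    ae_all_iff.2 fun b =>
      (Measure.tendsto_eval_ae_ae (μ := fun _ : Edge L => ρ) (i := b)).eventually hρ
  rw [ZLV_eq_avgPinnedZ, ZLVstar_eq_lintegral_tiltedZ, avgPinnedZ,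
    ← lintegral_const_mul' _ _ ENNReal.ofReal_ne_top, ← lintegral_const_mul' _ _ ENNReal.ofReal_ne_top,
    ← gaussInt_tilt_sq hD, ← gaussInt_tilt_sq (hD.trans_le hDO)]
  exact ⟨lintegral_mono_ae (hae.mono fun κ hκ => le_tiltedZ hD hκ),
    lintegral_mono_ae (hae.mono fun κ hκ => tiltedZ_le hD hκ)⟩

end Star

lemma log_toReal_le_log_add {a b K : ℝ≥0∞} (ha : a ≠ 0) (hb : b ≠ ∞) (hK : K ≠ ∞)
    (h : a ≤ K * b) : Real.log a.toReal ≤ Real.log K.toReal + Real.log b.toReal := by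
  have hK0 : K ≠ 0 := by rintro rfl; simp [ha] at h
  have hb0 : b ≠ 0 := by rintro rfl; simp [ha] at h
  have hKb : K * b ≠ ∞ := ENNReal.mul_ne_top hK hb
  rw [← Real.log_mul (ENNReal.toReal_ne_zero.2 ⟨hK0, hK⟩) (ENNReal.toReal_ne_zero.2 ⟨hb0, hb⟩),
    ← ENNReal.toReal_mul]
  exact Real.log_le_log (ENNReal.toReal_pos ha (ne_top_of_le_ne_top hKb h))
    (ENNReal.toReal_mono hKb h)

section FreeEnergy

variable {κO κD : ℝ} {ρ : Measure ℝ}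

lemma abs_log_sub_log_grid_le (L M n : ℕ) [NeZero L] (hn : (grid L M).card ≤ n)
    [IsProbabilityMeasure ρ] (hD : 0 < κD) (hDO : κD ≤ κO) (hρ : ∀ᵐ t ∂ρ, κD ≤ t ∧ t ≤ κO) :
    |Real.log (avgPinnedZ L {0} ρ).toReal - Real.log (avgPinnedZ L (grid L M) ρ).toReal| ≤
      n * Real.log (pinCost κO κD).toReal := by
  obtain ⟨h1, h2⟩ := avgPinnedZ_grid_compare L M hD hDO hρ
  obtain ⟨h0, ht⟩ := avgPinnedZ_zero_ne L hD hDO hρ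
  have hC := pinCost_ne_top hD hDO
  have hCn : pinCost κO κD ^ (grid L M).card ≠ ∞ := ENNReal.pow_ne_top hC
  have hg0 : avgPinnedZ L (grid L M) ρ ≠ 0 := by
    intro h; rw [h, mul_zero] at h1; exact h0 (le_antisymm h1 bot_le)
  have hgt : avgPinnedZ L (grid L M) ρ ≠ ∞ := ne_top_of_le_ne_top (ENNReal.mul_ne_top hCn ht) h2
  have l1 := log_toReal_le_log_add h0 hgt hCn h1
  have l2 := log_toReal_le_log_add hg0 ht hCn h2
  rw [ENNReal.toReal_pow, Real.log_pow] at l1 l2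
  have hlog : 0 ≤ Real.log (pinCost κO κD).toReal :=
    Real.log_nonneg (by simpa using ENNReal.toReal_mono hC one_le_pinCost)
  have hle : ((grid L M).card : ℝ) * Real.log (pinCost κO κD).toReal ≤
      n * Real.log (pinCost κO κD).toReal :=
    mul_le_mul_of_nonneg_right (by exact_mod_cast hn) hlog
  rw [abs_le]; constructor <;> linarith

/-- The free energy of the torus of side `k * M` agrees with that of `k ^ 2` tori of side `M`
up to a boundary term. -/
lemma abs_log_mul_sub_le (k M : ℕ) [NeZero k] [NeZero M]
    [IsProbabilityMeasure ρ] (hD : 0 < κD) (hDO : κD ≤ κO) (hρ : ∀ᵐ t ∂ρ, κD ≤ t ∧ t ≤ κO) :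
    |Real.log (avgPinnedZ (k * M) {0} ρ).toReal - k ^ 2 * Real.log (avgPinnedZ M {0} ρ).toReal| ≤
      4 * (k ^ 2 * M) * Real.log (pinCost κO κD).toReal := by
  have h1 := abs_log_sub_log_grid_le (k * M) M _ (card_grid_mul_le k M) hD hDO hρ
  have h2 := abs_log_sub_log_grid_le M M _ (card_grid_self_le M) hD hDO hρ
  rw [avgPinnedZ_grid_mul, ENNReal.toReal_pow, Real.log_pow] at h1
  have hk : (0 : ℝ) ≤ (k : ℝ) ^ 2 := sq_nonneg _
  push_cast at h1 h2
  rw [abs_le] at h1 h2 ⊢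
  have h3 := mul_le_mul_of_nonneg_left h2.1 hk
  have h4 := mul_le_mul_of_nonneg_left h2.2 hk
  constructor <;> nlinarith [h1.1, h1.2]

lemma abs_density_sub_le (k M : ℕ) [NeZero k] [NeZero M]
    [IsProbabilityMeasure ρ] (hD : 0 < κD) (hDO : κD ≤ κO) (hρ : ∀ᵐ t ∂ρ, κD ≤ t ∧ t ≤ κO) :
    |Real.log (avgPinnedZ (k * M) {0} ρ).toReal / ((k * M : ℕ) : ℝ) ^ 2 -
        Real.log (avgPinnedZ M {0} ρ).toReal / (M : ℝ) ^ 2| ≤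
      4 * Real.log (pinCost κO κD).toReal / M := by
  have hk : (0 : ℝ) < k := Nat.cast_pos.2 (NeZero.pos k)
  have hM : (0 : ℝ) < M := Nat.cast_pos.2 (NeZero.pos M)
  have h := abs_log_mul_sub_le (ρ := ρ) k M hD hDO hρ
  have hpos : (0 : ℝ) < ((k : ℝ) * M) ^ 2 := by positivity
  push_cast
  have e1 : ∀ X Y : ℝ, X / ((k : ℝ) * M) ^ 2 - Y / (M : ℝ) ^ 2 =
      (X - k ^ 2 * Y) / ((k : ℝ) * M) ^ 2 := fun X Y => by field_simp
  rw [e1, abs_div, abs_of_pos hpos, div_le_iff₀ hpos]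
  refine h.trans (le_of_eq ?_)
  field_simp

lemma abs_density_sub_density_le (L M : ℕ) [NeZero L] [NeZero M]
    [IsProbabilityMeasure ρ] (hD : 0 < κD) (hDO : κD ≤ κO) (hρ : ∀ᵐ t ∂ρ, κD ≤ t ∧ t ≤ κO) :
    |Real.log (avgPinnedZ L {0} ρ).toReal / (L : ℝ) ^ 2 -
        Real.log (avgPinnedZ M {0} ρ).toReal / (M : ℝ) ^ 2| ≤
      4 * Real.log (pinCost κO κD).toReal / L + 4 * Real.log (pinCost κO κD).toReal / M := by
  have h1 := abs_density_sub_le (ρ := ρ) L M hD hDO hρ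
  have h2 := abs_density_sub_le (ρ := ρ) M L hD hDO hρ
  have hcomm : ∀ N N' : ℕ, [NeZero N] → [NeZero N'] → N = N' →
      Real.log (avgPinnedZ N {0} ρ).toReal / (N : ℝ) ^ 2 =
        Real.log (avgPinnedZ N' {0} ρ).toReal / (N' : ℝ) ^ 2 := by
    intro N N' _ _ h; subst h; rfl
  rw [hcomm (M * L) (L * M) (mul_comm _ _)] at h2
  rw [abs_le] at h1 h2 ⊢
  constructor <;> linarith [h1.1, h1.2, h2.1, h2.2]

end FreeEnergy

lemma tendsto_log_mul_div_atTop {c : ℝ} (hc : 0 < c) :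
    Tendsto (fun x : ℝ => Real.log (c * x) / x) atTop (nhds 0) := by
  have h1 : Tendsto (fun x : ℝ => Real.log c / x + Real.log x / x) atTop (nhds (0 + 0)) :=
    (tendsto_const_nhds.div_atTop tendsto_id).add
      Real.isLittleO_log_id_atTop.tendsto_div_nhds_zero
  rw [add_zero] at h1
  refine h1.congr' ?_
  filter_upwards [eventually_gt_atTop 0] with x hx
  rw [Real.log_mul hc.ne' hx.ne', add_div]

lemma isProbabilityMeasure_rhoTwo (κO κD : ℝ) {p : ℝ} (hp : p ∈ Set.Icc (0 : ℝ) 1) :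
    IsProbabilityMeasure (rhoTwo κO κD p) := by
  refine ⟨?_⟩
  simp only [rhoTwo, Measure.add_apply, Measure.smul_apply, measure_univ, smul_eq_mul, mul_one]
  rw [← ENNReal.ofReal_add hp.1 (sub_nonneg.2 hp.2)]
  simp

lemma rhoTwo_ae_mem {κO κD : ℝ} (hDO : κD ≤ κO) (p : ℝ) :
    ∀ᵐ t ∂(rhoTwo κO κD p), κD ≤ t ∧ t ≤ κO := by
  unfold rhoTwo
  rw [ae_add_measure_iff]
  constructor <;> refine Measure.ae_smul_measure ?_ _ <;> rw [ae_dirac_eq]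
  · exact ⟨hDO, le_rfl⟩
  · exact ⟨le_rfl, hDO⟩

/-- along even `L → ∞`, the free energies per site of `Z_{L,V}`
and `Z*_{L,V}` exist and coincide. -/
theorem free_energies_exist_and_agree (κO κD : ℝ) (hD : 0 < κD) (hDO : κD < κO)
    (p : ℝ) (hp : p ∈ Set.Icc (0 : ℝ) 1) :
    ∃ A : ℝ,
      Tendsto
        (fun n : ℕ =>
          Real.log (ZLV (2 * (n + 1)) (rhoTwo κO κD p)).toReal /
            (2 * (n + 1) : ℝ) ^ 2)
        atTop (nhds A) ∧
      Tendsto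
        (fun n : ℕ =>
          Real.log (ZLVstar (2 * (n + 1)) (rhoTwo κO κD p)).toReal /
            (2 * (n + 1) : ℝ) ^ 2)
        atTop (nhds A) := by
  have : IsProbabilityMeasure (rhoTwo κO κD p) := isProbabilityMeasure_rhoTwo κO κD hp
  have hρ := rhoTwo_ae_mem hDO.le p
  have hcast : ∀ n : ℕ, ((2 * (n + 1) : ℕ) : ℝ) = 2 * (n + 1) := fun n => by push_cast; ring
  have hside : Tendsto (fun n : ℕ => (2 * (n + 1) : ℝ)) atTop atTop :=
    (tendsto_natCast_atTop_atTop.atTop_add tendsto_const_nhds).const_mul_atTop two_pos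
  have hside2 : Tendsto (fun n : ℕ => (2 * (n + 1) : ℝ) ^ 2) atTop atTop :=
    (tendsto_pow_atTop two_ne_zero).comp hside
  set K : ℝ := 4 * Real.log (pinCost κO κD).toReal with hK
  have hK0 : 0 ≤ K := mul_nonneg (by norm_num) (Real.log_nonneg
    (by simpa using ENNReal.toReal_mono (pinCost_ne_top hD hDO.le) one_le_pinCost))
  have hcauchy : CauchySeq fun n : ℕ =>
      Real.log (ZLV (2 * (n + 1)) (rhoTwo κO κD p)).toReal / (2 * (n + 1) : ℝ) ^ 2 := by
    refine cauchySeq_of_le_tendsto_0 (fun N : ℕ => K / (2 * (N + 1) : ℝ) + K / (2 * (N + 1) : ℝ))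
      (fun n m N hn hm => ?_) ?_
    · have h := abs_density_sub_density_le (ρ := rhoTwo κO κD p) (2 * (n + 1)) (2 * (m + 1))
        hD hDO.le hρ
      rw [hcast, hcast, ← ZLV_eq_avgPinnedZ, ← ZLV_eq_avgPinnedZ] at h
      rw [Real.dist_eq]
      refine h.trans (add_le_add ?_ ?_) <;> gcongr
    · simpa using (tendsto_const_nhds.div_atTop hside).add (tendsto_const_nhds.div_atTop hside)
  obtain ⟨A, hA⟩ := cauchySeq_tendsto_of_complete hcauchy
  refine ⟨A, hA, ?_⟩
  have hcO : 0 < 2 * π / κO := div_pos (by positivity) (hD.trans hDO)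
  have hcD : 0 < 2 * π / κD := div_pos (by positivity) hD
  have hlow := hA.add ((tendsto_log_mul_div_atTop hcO).comp hside2)
  have hup := hA.add ((tendsto_log_mul_div_atTop hcD).comp hside2)
  rw [add_zero] at hlow hup
  have key : ∀ n : ℕ,
      Real.log (ZLV (2 * (n + 1)) (rhoTwo κO κD p)).toReal +
          Real.log (2 * π / κO * (2 * (n + 1) : ℝ) ^ 2) ≤
        Real.log (ZLVstar (2 * (n + 1)) (rhoTwo κO κD p)).toReal ∧
      Real.log (ZLVstar (2 * (n + 1)) (rhoTwo κO κD p)).toReal ≤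
        Real.log (ZLV (2 * (n + 1)) (rhoTwo κO κD p)).toReal +
          Real.log (2 * π / κD * (2 * (n + 1) : ℝ) ^ 2) := by
    intro n
    have hne := avgPinnedZ_zero_ne (2 * (n + 1)) hD hDO.le hρ
    have hb := ZLVstar_bounds (L := 2 * (n + 1)) hD hDO.le hρ
    rw [← ZLV_eq_avgPinnedZ] at hne
    rw [hcast] at hb
    have hposO : 0 < 2 * π / κO * (2 * (n + 1) : ℝ) ^ 2 := by positivity
    have hposD : 0 < 2 * π / κD * (2 * (n + 1) : ℝ) ^ 2 := by positivity
    have hstar0 : ZLVstar (2 * (n + 1)) (rhoTwo κO κD p) ≠ 0 := fun h => by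
      rw [h] at hb
      rcases mul_eq_zero.1 (le_antisymm hb.1 bot_le) with h | h
      · exact (ENNReal.ofReal_pos.2 hposO).ne' h
      · exact hne.1 h
    have hstart : ZLVstar (2 * (n + 1)) (rhoTwo κO κD p) ≠ ∞ :=
      ne_top_of_le_ne_top (ENNReal.mul_ne_top ENNReal.ofReal_ne_top hne.2) hb.2
    constructor
    · have h := log_toReal_le_log_add (mul_ne_zero (ENNReal.ofReal_pos.2 hposO).ne' hne.1)
        hstart ENNReal.one_ne_top (by rw [one_mul]; exact hb.1)
      rw [ENNReal.toReal_mul, ENNReal.toReal_ofReal hposO.le, Real.log_mul hposO.ne'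
        (ENNReal.toReal_ne_zero.2 hne), ENNReal.toReal_one, Real.log_one] at h
      linarith
    · have h := log_toReal_le_log_add hstar0 hne.2 ENNReal.ofReal_ne_top hb.2
      rw [ENNReal.toReal_ofReal hposD.le] at h
      linarith
  refine tendsto_of_tendsto_of_tendsto_of_le_of_le hlow hup (fun n => ?_) (fun n => ?_)
  · simp only [Function.comp_apply, ← add_div]
    exact div_le_div_of_nonneg_right (key n).1 (sq_nonneg _)
  · simp only [Function.comp_apply, ← add_div]
    exact div_le_div_of_nonneg_right (key n).2 (sq_nonneg _)

end
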